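/- Let n ≥ 4 be an integer and p a prime. The number of ordered pairs (C, C') with C, C' ∈ R^(n)(p) = R₀^(n)(p) ∪ R₁^(n)(p) such that the product C·C' belongs to the right coset Λ_n·diag(1, p², …, p², p³, p³) (with n−3 entries equal to p²) equals p + 1. -/

import Mathlib

open Matrix

/-- `Λ_n = GL_n(ℤ)` viewed inside the `n × n` rational matrices: the matrices with integer
entries whose determinant is `±1`. -/
def Lambda (n : ℕ) : Set (Matrix (Fin n) (Fin n) ℚ) :=
  {γ | (∀ i j, ∃ z : ℤ, γ i j = (z : ℚ)) ∧ (γ.det = 1 ∨ γ.det = -1)}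

/-- The right coset `Λ_n h = {γ * h : γ ∈ Λ_n}`. -/
def rightCoset (n : ℕ) (h : Matrix (Fin n) (Fin n) ℚ) : Set (Matrix (Fin n) (Fin n) ℚ) :=
  {m | ∃ γ ∈ Lambda n, m = γ * h}

/-- The double coset `Λ_n g Λ_n = {γ₁ * g * γ₂ : γ₁, γ₂ ∈ Λ_n}`. -/
def doubleCoset (n : ℕ) (g : Matrix (Fin n) (Fin n) ℚ) : Set (Matrix (Fin n) (Fin n) ℚ) :=
  {m | ∃ γ₁ ∈ Lambda n, ∃ γ₂ ∈ Lambda n, m = γ₁ * g * γ₂}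

/-- The degree of `g`: the number of distinct right cosets `Λ_n h` contained in `Λ_n g Λ_n`. -/
noncomputable def degree (n : ℕ) (g : Matrix (Fin n) (Fin n) ℚ) : ℕ :=
  Set.ncard {S : Set (Matrix (Fin n) (Fin n) ℚ) | ∃ h ∈ doubleCoset n g, S = rightCoset n h}

/-- The `k`-th determinantal divisor of an `n × n` integer matrix: the gcd of all of its
`k × k` minors (which is `0` when all these minors vanish), a minor being indexed by a pair
of strictly increasing maps `Fin k → Fin n` selecting rows and columns. -/
def detDiv (n k : ℕ) (C : Matrix (Fin n) (Fin n) ℤ) : ℤ :=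
  Finset.gcd ((Finset.univ : Finset ((Fin k → Fin n) × (Fin k → Fin n))).filter
      (fun fg => (∀ a b : Fin k, a < b → fg.1 a < fg.1 b) ∧
        (∀ a b : Fin k, a < b → fg.2 a < fg.2 b)))
    (fun fg => (C.submatrix fg.1 fg.2).det)

/-- `D^(n)(p) = diag(1, p, …, p, p²)` with `n - 2` middle diagonal entries equal to `p`. -/
def Dmat (n p : ℕ) : Matrix (Fin n) (Fin n) ℤ :=
  Matrix.diagonal (fun i => if i.val = 0 then 1 else if i.val = n - 1 then (p : ℤ) ^ 2 else (p : ℤ))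

/-- The set `R₀^(n)(p)` of upper-triangular integer matrices whose determinantal divisors are
`d_k = p^(k-1)` for `1 ≤ k ≤ n - 1` and `d_n = p^n`, whose diagonal entries all equal `p`, and
whose above-diagonal entries lie in `[0, p)`. -/
def R0 (n p : ℕ) : Set (Matrix (Fin n) (Fin n) ℤ) :=
  {C | (∀ i j : Fin n, j < i → C i j = 0) ∧
    (∀ k : ℕ, 1 ≤ k → k ≤ n - 1 → detDiv n k C = (p : ℤ) ^ (k - 1)) ∧
    detDiv n n C = (p : ℤ) ^ n ∧
    (∀ i : Fin n, C i i = (p : ℤ)) ∧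
    (∀ i j : Fin n, i < j → 0 ≤ C i j ∧ C i j < (p : ℤ))}

/-- The set `R₁^(n)(p)` of upper-triangular integer matrices whose diagonal entries lie in
`{1, p, p²}` with exactly one entry `1` and exactly one entry `p²`, whose above-diagonal
entries satisfy `0 ≤ c i j < c j j`, and such that `p ∣ c i i` implies `p ∣ c i j` for `j > i`. -/
def R1 (n p : ℕ) : Set (Matrix (Fin n) (Fin n) ℤ) :=
  {C | (∀ i j : Fin n, j < i → C i j = 0) ∧
    (∀ i : Fin n, C i i = 1 ∨ C i i = (p : ℤ) ∨ C i i = (p : ℤ) ^ 2) ∧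
    (∃! i : Fin n, C i i = 1) ∧
    (∃! i : Fin n, C i i = (p : ℤ) ^ 2) ∧
    (∀ i j : Fin n, i < j → 0 ≤ C i j ∧ C i j < C j j) ∧
    (∀ i j : Fin n, i < j → (p : ℤ) ∣ C i i → (p : ℤ) ∣ C i j)}

/-- Casting an integer matrix to a rational matrix. -/
def toQ (n : ℕ) (C : Matrix (Fin n) (Fin n) ℤ) : Matrix (Fin n) (Fin n) ℚ :=
  C.map (fun z : ℤ => (z : ℚ))

/-- For an upper-triangular integer matrix with positive diagonal, lying in the right coset of a
positive diagonal matrix means having that diagonal and columns divisible by its entries. -/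
lemma toQ_mem_rightCoset_diagonal_iff {n : ℕ} {M : Matrix (Fin n) (Fin n) ℤ} {h : Fin n → ℤ}
    (hM : ∀ i j, j < i → M i j = 0) (hpos : ∀ i, 0 < M i i) (hh : ∀ i, 0 < h i) :
    toQ n M ∈ rightCoset n (Matrix.diagonal fun i => (h i : ℚ)) ↔
      (∀ i, M i i = h i) ∧ ∀ i j, h j ∣ M i j := by
  constructor
  · rintro ⟨γ, ⟨hγ, hdet⟩, hM'⟩
    choose z hz using hγ
    have hent : ∀ i j, M i j = z i j * h j := by
      intro i j
      have := congrFun (congrFun hM' i) j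
      rw [Matrix.mul_diagonal, hz] at this
      simp only [toQ, Matrix.map_apply] at this
      exact_mod_cast this
    have hγz : γ = (Matrix.of z).map (Int.castRingHom ℚ) := by
      ext i j
      simp [hz]
    have htri : (Matrix.of z).BlockTriangular id := by
      intro i j hij
      have := hM i j hij
      rw [hent] at this
      exact (mul_eq_zero.mp this).resolve_right (hh j).ne'
    have hunit : IsUnit (∏ i, z i i) := by
      have h1 : γ.det = ((∏ i, z i i : ℤ) : ℚ) := by
        rw [hγz, ← RingHom.mapMatrix_apply, ← RingHom.map_det, Matrix.det_of_isUpperTriangular htri]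
        simp
      rw [h1] at hdet
      rw [Int.isUnit_iff]
      exact_mod_cast hdet
    refine ⟨fun i => ?_, fun i j => ⟨z i j, by rw [hent, mul_comm]⟩⟩
    have hzi : IsUnit (z i i) := isUnit_of_dvd_unit
      (Finset.dvd_prod_of_mem (fun i => z i i) (Finset.mem_univ i)) hunit
    have hp := hpos i
    rw [hent] at hp ⊢
    have hz0 : 0 < z i i := pos_of_mul_pos_left hp (hh i).le
    rcases Int.isUnit_iff.mp hzi with h1 | h1 <;> simp_all
  · rintro ⟨hd, hdvd⟩
    choose z hz using hdvd
    have hz1 : ∀ i, z i i = 1 := by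
      intro i
      have := hz i i
      rw [hd] at this
      exact (mul_right_eq_self₀.mp this.symm).resolve_right (hh i).ne'
    have htri : (Matrix.of z).BlockTriangular id := by
      intro i j hij
      have := hM i j hij
      rw [hz] at this
      exact (mul_eq_zero.mp this).resolve_left (hh j).ne'
    refine ⟨(Matrix.of z).map (Int.castRingHom ℚ), ⟨fun i j => ⟨z i j, by simp⟩, Or.inl ?_⟩, ?_⟩
    · rw [← RingHom.mapMatrix_apply, ← RingHom.map_det, Matrix.det_of_isUpperTriangular htri]
      simp [hz1]
    · ext i j
      simp [toQ, Matrix.mul_diagonal, hz i j, mul_comm]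

lemma mul_apply_self_of_upper {n : ℕ} {A B : Matrix (Fin n) (Fin n) ℤ}
    (hA : ∀ i j, j < i → A i j = 0) (hB : ∀ i j, j < i → B i j = 0) (i : Fin n) :
    (A * B) i i = A i i * B i i := by
  rw [Matrix.mul_apply]
  refine Finset.sum_eq_single i (fun k _ hk => ?_) (by simp)
  rcases lt_or_gt_of_ne hk with h | h
  · simp [hA _ _ h]
  · simp [hB _ _ h]

lemma mul_apply_of_upper_of_eq_zero {n : ℕ} {A B : Matrix (Fin n) (Fin n) ℤ}
    (hA : ∀ i j, j < i → A i j = 0) (hB : ∀ i j, j < i → B i j = 0) {i j : Fin n} (hij : i < j)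
    (h0 : ∀ k, i < k → k < j → A i k = 0) :
    (A * B) i j = A i i * B i j + A i j * B j j := by
  rw [Matrix.mul_apply]
  refine Finset.sum_eq_add i j hij.ne (fun k _ hk => ?_) (by simp) (by simp)
  rcases lt_or_gt_of_ne hk.1 with h | h
  · simp [hA _ _ h]
  · rcases lt_or_gt_of_ne hk.2 with h' | h'
    · simp [h0 k h h']
    · simp [hB _ _ h']

lemma eq_zero_of_dvd_mul_add_mul {a b x y s t : ℤ} (ha : 0 < a) (hx : 0 ≤ x) (hxs : x < s)
    (hy : 0 ≤ y) (hyt : y < t) (hay : a ∣ y) (hat : a ∣ t) (h : t * s ∣ a * x + y * s)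
    (hb : b = s) : x = 0 ∧ y = 0 := by
  subst hb
  have hyt' : y + a ≤ t := by
    have := Int.le_of_dvd (by linarith) (dvd_sub hat hay)
    linarith
  have hb : 0 < b := by linarith
  have hlt : a * x + y * b < t * b := by nlinarith
  have h0 := Int.eq_zero_of_dvd_of_nonneg_of_lt (by positivity) hlt h
  have h1 : 0 ≤ a * x := by positivity
  have h2 : 0 ≤ y * b := by positivity
  constructor
  · exact (mul_eq_zero.mp (by linarith : a * x = 0)).resolve_left ha.ne'
  · exact (mul_eq_zero.mp (by linarith : y * b = 0)).resolve_right hb.ne'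

/-- The diagonal entries `h_j = 1, p², …, p², p³, p³`. -/
def targetDiag (n p : ℕ) (i : Fin n) : ℤ :=
  if i.val = 0 then 1 else if n - 2 ≤ i.val then (p : ℤ) ^ 3 else (p : ℤ) ^ 2

/-- The matrix with diagonal `1, p, …, p` except for `p²` in position `s`, and whose only possibly
nonzero off-diagonal entry is `p * c` in position `(n - 2, n - 1)`. -/
def solutionMatrix (n p s : ℕ) (c : ℕ) : Matrix (Fin n) (Fin n) ℤ :=
  Matrix.of fun i j =>
    if i = j then if i.val = 0 then 1 else if i.val = s then (p : ℤ) ^ 2 else p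
    else if i.val = n - 2 ∧ j.val = n - 1 then (p : ℤ) * c else 0

lemma solutionMatrix_mem_R1 {n p s c : ℕ} (hn : 4 ≤ n) (hp : p.Prime)
    (hs : s = n - 1 ∧ c < p ∨ s = n - 2 ∧ c = 0) : solutionMatrix n p s c ∈ R1 n p := by
  have hp1 : (1 : ℤ) < p := by exact_mod_cast hp.one_lt
  have hpp : (p : ℤ) < (p : ℤ) ^ 2 := by nlinarith
  have hsn : s < n := by omega
  refine ⟨fun i j hij => ?_, fun i => ?_, ⟨⟨0, by omega⟩, by simp [solutionMatrix], ?_⟩,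
    ⟨⟨s, hsn⟩, ?_, ?_⟩, fun i j hij => ?_, fun i j hij hd => ?_⟩
  · have : i.val ≠ n - 2 ∨ j.val ≠ n - 1 := by
      have := j.isLt; have : j.val < i.val := hij; omega
    simp only [solutionMatrix, Matrix.of_apply, if_neg hij.ne']
    rw [if_neg (by tauto)]
  · simp only [solutionMatrix, Matrix.of_apply, if_true]
    split_ifs <;> simp
  · intro i hi
    simp only [solutionMatrix, Matrix.of_apply, if_true] at hi
    split_ifs at hi with h1 h2
    · exact Fin.ext h1
    · omega
    · omega
  · have : s ≠ 0 := by omega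
    simp [solutionMatrix, this]
  · intro i hi
    simp only [solutionMatrix, Matrix.of_apply, if_true] at hi
    split_ifs at hi with h1 h2
    · omega
    · exact Fin.ext h2
    · omega
  · have hj0 : j.val ≠ 0 := by have : i.val < j.val := hij; omega
    simp only [solutionMatrix, Matrix.of_apply, if_neg hij.ne, if_true, if_neg hj0]
    split_ifs with h1 h2 h2
    · refine ⟨by positivity, ?_⟩
      have : (c : ℤ) < p := by
        have := hp.pos
        exact_mod_cast (by omega : c < p)
      nlinarith
    · have : c = 0 := by omega
      subst this
      simpa using hp.pos
    · exact ⟨le_rfl, by positivity⟩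
    · exact ⟨le_rfl, by positivity⟩
  · simp only [solutionMatrix, Matrix.of_apply, if_neg hij.ne]
    split_ifs <;> simp

lemma R0_union_R1_upper {n p : ℕ} {C : Matrix (Fin n) (Fin n) ℤ} (hC : C ∈ R0 n p ∪ R1 n p) :
    ∀ i j, j < i → C i j = 0 := by
  rcases hC with hC | hC <;> exact hC.1

lemma R0_union_R1_diag {n p : ℕ} {C : Matrix (Fin n) (Fin n) ℤ} (hC : C ∈ R0 n p ∪ R1 n p)
    (i : Fin n) : C i i = 1 ∨ C i i = p ∨ C i i = (p : ℤ) ^ 2 := by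
  rcases hC with hC | hC
  · exact Or.inr (Or.inl (hC.2.2.2.1 i))
  · exact hC.2.1 i

lemma R0_union_R1_diag_pos {n p : ℕ} (hp : p.Prime) {C : Matrix (Fin n) (Fin n) ℤ}
    (hC : C ∈ R0 n p ∪ R1 n p) (i : Fin n) : 0 < C i i := by
  have : (0 : ℤ) < p := by exact_mod_cast hp.pos
  rcases R0_union_R1_diag hC i with h | h | h <;> rw [h] <;> positivity

lemma targetDiag_pos {n p : ℕ} (hp : p.Prime) (i : Fin n) : 0 < targetDiag n p i := by
  have : (0 : ℤ) < p := by exact_mod_cast hp.pos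
  unfold targetDiag
  split_ifs <;> positivity

lemma toQ_mul_mem_rightCoset_iff {n p : ℕ} (hp : p.Prime) {A B : Matrix (Fin n) (Fin n) ℤ}
    (hA : A ∈ R0 n p ∪ R1 n p) (hB : B ∈ R0 n p ∪ R1 n p) :
    toQ n (A * B) ∈ rightCoset n (Matrix.diagonal fun i : Fin n =>
      if i.val = 0 then (1 : ℚ) else if n - 2 ≤ i.val then (p : ℚ) ^ 3 else (p : ℚ) ^ 2) ↔
      (∀ i, A i i * B i i = targetDiag n p i) ∧ ∀ i j, targetDiag n p j ∣ (A * B) i j := by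
  have hA0 := R0_union_R1_upper hA
  have hB0 := R0_union_R1_upper hB
  have hd : (fun i : Fin n => if i.val = 0 then (1 : ℚ) else if n - 2 ≤ i.val then (p : ℚ) ^ 3
      else (p : ℚ) ^ 2) = fun i => (targetDiag n p i : ℚ) := by
    funext i
    unfold targetDiag
    split_ifs <;> simp
  rw [hd, toQ_mem_rightCoset_diagonal_iff _ _ (targetDiag_pos hp)]
  · simp only [mul_apply_self_of_upper hA0 hB0]
  · exact Matrix.BlockTriangular.mul (b := id) (fun i j h => hA0 i j h) (fun i j h => hB0 i j h)
  · intro i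
    rw [mul_apply_self_of_upper hA0 hB0]
    exact mul_pos (R0_union_R1_diag_pos hp hA i) (R0_union_R1_diag_pos hp hB i)

lemma mem_R1_of_apply_eq_one {n p : ℕ} (hp : p.Prime) {C : Matrix (Fin n) (Fin n) ℤ}
    (hC : C ∈ R0 n p ∪ R1 n p) {i : Fin n} (hi : C i i = 1) : C ∈ R1 n p := by
  refine hC.resolve_left fun h => hp.one_lt.ne' ?_
  have := h.2.2.2.1 i
  rw [hi] at this
  exact_mod_cast this.symm

lemma R1_diag_eq {n p s : ℕ} {C : Matrix (Fin n) (Fin n) ℤ} (hC : C ∈ R1 n p) {z t : Fin n}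
    (hz : z.val = 0) (hz1 : C z z = 1) (ht : t.val = s) (hts : C t t = (p : ℤ) ^ 2) (i : Fin n) :
    C i i = if i.val = 0 then 1 else if i.val = s then (p : ℤ) ^ 2 else p := by
  obtain ⟨-, hd, h1, h2, -⟩ := hC
  split_ifs with hi hi'
  · rwa [Fin.ext (hi.trans hz.symm)]
  · rwa [Fin.ext (hi'.trans ht.symm)]
  · rcases hd i with h | h | h
    · exact absurd ((congrArg Fin.val (h1.unique h hz1)).trans hz) hi
    · exact h
    · exact absurd ((congrArg Fin.val (h2.unique h hts)).trans ht) hi'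

lemma apply_eq_zero_of_coset {n p : ℕ} (hp : p.Prime) {A B : Matrix (Fin n) (Fin n) ℤ}
    (hA : A ∈ R1 n p) (hB : B ∈ R1 n p)
    (hd : ∀ i, A i i * B i i = targetDiag n p i) (hdvd : ∀ i j, targetDiag n p j ∣ (A * B) i j)
    {i j : Fin n} (hij : i < j) (hAi : A i i = 1 ∨ A i i = p) (hAj : (p : ℤ) ∣ A j j)
    (h0 : ∀ k, i < k → k < j → A i k = 0) : B i j = 0 ∧ A i j = 0 := by
  have hp0 : (0 : ℤ) < p := by exact_mod_cast hp.pos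
  obtain ⟨hxl, hxu⟩ := hB.2.2.2.2.1 i j hij
  obtain ⟨hyl, hyu⟩ := hA.2.2.2.2.1 i j hij
  have h := hdvd i j
  rw [← hd, mul_apply_of_upper_of_eq_zero hA.1 hB.1 hij h0] at h
  refine eq_zero_of_dvd_mul_add_mul ?_ hxl hxu hyl hyu ?_ ?_ h rfl
  · rcases hAi with h | h <;> rw [h] <;> omega
  · rcases hAi with h | h
    · simp [h]
    · have := hA.2.2.2.2.2 i j hij (by rw [h])
      rwa [h]
  · rcases hAi with h | h <;> simp [h, hAj]

lemma solution_eq {n p s t : ℕ} (hn : 4 ≤ n) (hp : p.Prime) {A B : Matrix (Fin n) (Fin n) ℤ}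
    (hA : A ∈ R1 n p) (hB : B ∈ R1 n p)
    (hd : ∀ i, A i i * B i i = targetDiag n p i) (hdvd : ∀ i j, targetDiag n p j ∣ (A * B) i j)
    (hs : s = n - 2 ∧ t = n - 1 ∨ s = n - 1 ∧ t = n - 2)
    (hAd : ∀ i : Fin n, A i i = if i.val = 0 then 1 else if i.val = s then (p : ℤ) ^ 2 else p)
    (hBd : ∀ i : Fin n, B i i = if i.val = 0 then 1 else if i.val = t then (p : ℤ) ^ 2 else p) :
    A = solutionMatrix n p s 0 ∧
      ∃ c : ℕ, c < p ∧ (t = n - 2 → c = 0) ∧ B = solutionMatrix n p t c := by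
  have hp0 : (0 : ℤ) < p := by exact_mod_cast hp.pos
  have hAj : ∀ i j : Fin n, i < j → (p : ℤ) ∣ A j j := by
    intro i j hij
    have : i.val < j.val := hij
    rw [hAd, if_neg (by omega)]
    split_ifs
    · exact dvd_pow_self _ two_ne_zero
    · exact dvd_rfl
  have hAi : ∀ i : Fin n, i.val ≠ s → A i i = 1 ∨ A i i = p := by
    intro i hi
    rw [hAd, if_neg hi]
    split_ifs <;> simp
  have hcorner : ∀ i j : Fin n, i < j → i.val = s → s = n - 2 ∧ j.val = n - 1 := by
    intro i j hij hi
    have : i.val < j.val := hij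
    have := j.isLt
    omega
  have hA0 : ∀ m : ℕ, ∀ i j : Fin n, j.val = m → i < j → A i j = 0 := by
    intro m
    induction m using Nat.strong_induction_on with
    | _ m ih =>
      intro i j hj hij
      by_cases hi : i.val = s
      · obtain ⟨hs', hj'⟩ := hcorner i j hij hi
        have hAjp : A j j = p := by
          rw [hAd, if_neg (by omega), if_neg (by omega)]
        obtain ⟨h1, h2⟩ := hA.2.2.2.2.1 i j hij
        refine Int.eq_zero_of_dvd_of_nonneg_of_lt h1 (hAjp ▸ h2)
          (hA.2.2.2.2.2 i j hij ?_)
        rw [hAd, if_neg (by omega), if_pos hi]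
        exact dvd_pow_self _ two_ne_zero
      · exact (apply_eq_zero_of_coset hp hA hB hd hdvd hij (hAi i hi) (hAj i j hij)
          fun k hik hkj => ih k.val (by rw [← hj]; exact hkj) i k rfl hik).2
  have hB0 : ∀ i j : Fin n, i < j → i.val ≠ s → B i j = 0 := fun i j hij hi =>
    (apply_eq_zero_of_coset hp hA hB hd hdvd hij (hAi i hi) (hAj i j hij)
      fun k hik _ => hA0 k.val i k rfl hik).1
  refine ⟨?_, ?_⟩
  · ext i j
    rcases lt_trichotomy i j with h | h | h
    · simp [solutionMatrix, h.ne, hA0 _ i j rfl h]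
    · subst h
      simp [solutionMatrix, hAd]
    · simp [solutionMatrix, h.ne', hA.1 i j h]
  let u : Fin n := ⟨n - 2, by omega⟩
  let v : Fin n := ⟨n - 1, by omega⟩
  have huv : u < v := by
    change n - 2 < n - 1
    omega
  have hBu : B u u = if n - 2 = t then (p : ℤ) ^ 2 else p := by
    rw [hBd, if_neg (by change n - 2 ≠ 0; omega)]
  have hBv : B v v = if n - 1 = t then (p : ℤ) ^ 2 else p := by
    rw [hBd, if_neg (by change n - 1 ≠ 0; omega)]
  obtain ⟨hl, hu⟩ := hB.2.2.2.2.1 u v huv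
  obtain ⟨q, hq⟩ : (p : ℤ) ∣ B u v := by
    refine hB.2.2.2.2.2 u v huv ?_
    rw [hBu]
    split_ifs
    · exact dvd_pow_self _ two_ne_zero
    · exact dvd_rfl
  have hq0 : 0 ≤ q := by
    rw [hq] at hl
    exact nonneg_of_mul_nonneg_right hl hp0
  lift q to ℕ using hq0
  refine ⟨q, ?_, fun ht => ?_, ?_⟩
  · rw [hq, hBv] at hu
    have hpp : (p : ℤ) ≤ (p : ℤ) ^ 2 := by nlinarith
    have : (p : ℤ) * q < p * p := by
      split_ifs at hu <;> nlinarith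
    exact_mod_cast lt_of_mul_lt_mul_left this hp0.le
  · rw [hq, hBv, if_neg (by omega)] at hu
    have : (q : ℤ) < 1 := lt_of_mul_lt_mul_left (by linarith) hp0.le
    omega
  · ext i j
    rcases lt_trichotomy i j with h | h | h
    · by_cases hc : i.val = n - 2 ∧ j.val = n - 1
      · obtain rfl : i = u := Fin.ext hc.1
        obtain rfl : j = v := Fin.ext hc.2
        rw [hq]
        simp only [solutionMatrix, Matrix.of_apply, if_neg h.ne, if_pos hc]
      · have : i.val ≠ s := fun hi => by
          have := hcorner i j h hi
          omega
        simp only [solutionMatrix, Matrix.of_apply, if_neg h.ne, if_neg hc, hB0 i j h this]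
    · subst h
      simp [solutionMatrix, hBd]
    · have : ¬(i.val = n - 2 ∧ j.val = n - 1) := by
        have : j.val < i.val := h
        omega
      simp only [solutionMatrix, Matrix.of_apply, if_neg h.ne', if_neg this, hB.1 i j h]

lemma solutionMatrix_mul_mem {n p s t c : ℕ} (hn : 4 ≤ n) (hp : p.Prime)
    (hs : s = n - 2 ∧ t = n - 1 ∧ c < p ∨ s = n - 1 ∧ t = n - 2 ∧ c = 0) :
    toQ n (solutionMatrix n p s 0 * solutionMatrix n p t c) ∈
      rightCoset n (Matrix.diagonal fun i : Fin n =>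
        if i.val = 0 then (1 : ℚ) else if n - 2 ≤ i.val then (p : ℚ) ^ 3 else (p : ℚ) ^ 2) := by
  have hpp := hp.pos
  have hd : ∀ i, solutionMatrix n p s 0 i i * solutionMatrix n p t c i i = targetDiag n p i := by
    intro i
    have := i.isLt
    simp only [solutionMatrix, targetDiag, Matrix.of_apply, if_true]
    split_ifs <;> first | omega | ring
  rw [toQ_mul_mem_rightCoset_iff hp
    (Or.inr (solutionMatrix_mem_R1 hn hp (by omega)))
    (Or.inr (solutionMatrix_mem_R1 hn hp (by omega)))]
  refine ⟨hd, fun i j => ?_⟩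
  have hdiag : ∀ k, k ≠ i → solutionMatrix n p s 0 i k = 0 := by
    intro k hk
    simp [solutionMatrix, hk.symm]
  rw [Matrix.mul_apply, Finset.sum_eq_single i (fun k _ hk => by simp [hdiag k hk]) (by simp)]
  by_cases hij : i = j
  · rw [← hij, hd]
  by_cases hc : i.val = n - 2 ∧ j.val = n - 1
  · simp only [solutionMatrix, targetDiag, Matrix.of_apply, if_true, if_neg hij, if_pos hc]
    rw [if_neg (by omega), if_pos (by omega), if_neg (by omega)]
    rcases hs with h | h
    · rw [if_pos (by omega)]
      exact ⟨c, by ring⟩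
    · simp [h.2.2]
  · simp only [solutionMatrix, Matrix.of_apply, if_neg hij, if_neg hc, mul_zero, dvd_zero]

lemma mul_eq_pow_three_cases {p x y : ℤ} (hp : 1 < p) (hx : x = p ∨ x = p ^ 2)
    (hy : y = p ∨ y = p ^ 2) (h : x * y = p ^ 3) :
    x = p ^ 2 ∧ y = p ∨ x = p ∧ y = p ^ 2 := by
  rcases hx with rfl | rfl <;> rcases hy with rfl | rfl
  · exfalso
    nlinarith [mul_pos (sub_pos.2 hp) (pow_pos (zero_lt_one.trans hp) 2)]
  · exact Or.inr ⟨rfl, rfl⟩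
  · exact Or.inl ⟨rfl, rfl⟩
  · exfalso
    nlinarith [mul_pos (sub_pos.2 hp) (pow_pos (zero_lt_one.trans hp) 3)]

lemma solution_cases {n p : ℕ} (hn : 4 ≤ n) (hp : p.Prime) {A B : Matrix (Fin n) (Fin n) ℤ}
    (hA : A ∈ R0 n p ∪ R1 n p) (hB : B ∈ R0 n p ∪ R1 n p)
    (hd : ∀ i, A i i * B i i = targetDiag n p i)
    (hdvd : ∀ i j, targetDiag n p j ∣ (A * B) i j) :
    (A = solutionMatrix n p (n - 1) 0 ∧ B = solutionMatrix n p (n - 2) 0) ∨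
      ∃ c : ℕ, c < p ∧ A = solutionMatrix n p (n - 2) 0 ∧ B = solutionMatrix n p (n - 1) c := by
  have hp1 : (1 : ℤ) < p := by exact_mod_cast hp.one_lt
  let z : Fin n := ⟨0, by omega⟩
  let u : Fin n := ⟨n - 2, by omega⟩
  let v : Fin n := ⟨n - 1, by omega⟩
  have hz : A z z * B z z = 1 := by simpa [targetDiag, z] using hd z
  have hAz : A z z = 1 := Int.eq_one_of_mul_eq_one_right (R0_union_R1_diag_pos hp hA z).le hz
  have hBz : B z z = 1 := by simpa [hAz] using hz
  replace hA := mem_R1_of_apply_eq_one hp hA hAz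
  replace hB := mem_R1_of_apply_eq_one hp hB hBz
  have hne : ∀ i : Fin n, i.val ≠ 0 → (A i i = p ∨ A i i = (p : ℤ) ^ 2) ∧
      (B i i = p ∨ B i i = (p : ℤ) ^ 2) := fun i hi =>
    ⟨(hA.2.1 i).resolve_left fun h => hi (congrArg Fin.val (hA.2.2.1.unique h hAz)),
      (hB.2.1 i).resolve_left fun h => hi (congrArg Fin.val (hB.2.2.1.unique h hBz))⟩
  have hcases : ∀ i : Fin n, n - 2 ≤ i.val →
      A i i = (p : ℤ) ^ 2 ∧ B i i = p ∨ A i i = p ∧ B i i = (p : ℤ) ^ 2 := fun i hi => by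
    have hi0 : i.val ≠ 0 := by omega
    refine mul_eq_pow_three_cases hp1 (hne i hi0).1 (hne i hi0).2 ?_
    rw [hd, targetDiag, if_neg hi0, if_pos hi]
  have huv : u ≠ v := fun h => by
    have : n - 2 = n - 1 := congrArg Fin.val h
    omega
  rcases hcases u le_rfl with hu | hu <;>
    rcases hcases v (by change n - 2 ≤ n - 1; omega) with hv | hv
  · exact absurd (hA.2.2.2.1.unique hu.1 hv.1) huv
  · obtain ⟨h1, c, hc, -, h2⟩ := solution_eq hn hp hA hB hd hdvd (Or.inl ⟨rfl, rfl⟩)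
      (R1_diag_eq hA rfl hAz (t := u) rfl hu.1) (R1_diag_eq hB rfl hBz (t := v) rfl hv.2)
    exact Or.inr ⟨c, hc, h1, h2⟩
  · obtain ⟨h1, c, -, hc, h2⟩ := solution_eq hn hp hA hB hd hdvd (Or.inr ⟨rfl, rfl⟩)
      (R1_diag_eq hA rfl hAz (t := v) rfl hv.1) (R1_diag_eq hB rfl hBz (t := u) rfl hu.2)
    rw [hc rfl] at h2
    exact Or.inl ⟨h1, h2⟩
  · exact absurd (hB.2.2.2.1.unique hu.2 hv.2) huv

theorem statement16 (n p : ℕ) (hn : 4 ≤ n) (hp : p.Prime) :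
    {CC : Matrix (Fin n) (Fin n) ℤ × Matrix (Fin n) (Fin n) ℤ |
        CC.1 ∈ R0 n p ∪ R1 n p ∧ CC.2 ∈ R0 n p ∪ R1 n p ∧
        toQ n (CC.1 * CC.2) ∈ rightCoset n (Matrix.diagonal fun i : Fin n =>
      if i.val = 0 then (1 : ℚ) else if n - 2 ≤ i.val then (p : ℚ) ^ 3 else (p : ℚ) ^ 2)}.ncard =
      p + 1 := by
  have hp1 : (1 : ℤ) < p := by exact_mod_cast hp.one_lt
  have hset : {CC : Matrix (Fin n) (Fin n) ℤ × Matrix (Fin n) (Fin n) ℤ |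
        CC.1 ∈ R0 n p ∪ R1 n p ∧ CC.2 ∈ R0 n p ∪ R1 n p ∧
        toQ n (CC.1 * CC.2) ∈ rightCoset n (Matrix.diagonal fun i : Fin n =>
      if i.val = 0 then (1 : ℚ) else if n - 2 ≤ i.val then (p : ℚ) ^ 3 else (p : ℚ) ^ 2)} =
      insert (solutionMatrix n p (n - 1) 0, solutionMatrix n p (n - 2) 0)
        ((fun c : ℕ => (solutionMatrix n p (n - 2) 0, solutionMatrix n p (n - 1) c)) ''
          (Finset.range p : Set ℕ)) := by
    have hpp := hp.pos
    ext ⟨A, B⟩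
    simp only [Set.mem_ofPred_eq, Set.mem_insert_iff, Set.mem_image, Finset.coe_range,
      Set.mem_Iio, Prod.mk.injEq]
    constructor
    · rintro ⟨hA, hB, h⟩
      rw [toQ_mul_mem_rightCoset_iff hp hA hB] at h
      rcases solution_cases hn hp hA hB h.1 h.2 with h | ⟨c, hc, rfl, rfl⟩
      · exact Or.inl h
      · exact Or.inr ⟨c, hc, rfl, rfl⟩
    · rintro (⟨rfl, rfl⟩ | ⟨c, hc, rfl, rfl⟩) <;>
        exact ⟨Or.inr (solutionMatrix_mem_R1 hn hp (by omega)),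
          Or.inr (solutionMatrix_mem_R1 hn hp (by omega)), solutionMatrix_mul_mem hn hp (by omega)⟩
  rw [hset, Set.ncard_insert_of_notMem, Set.ncard_image_of_injective, Set.ncard_coe_finset,
    Finset.card_range]
  · intro c d hcd
    have h := congrFun (congrFun (congrArg Prod.snd hcd) ⟨n - 2, by omega⟩) ⟨n - 1, by omega⟩
    have hne : n - 2 ≠ n - 1 := by omega
    have hp0 : p ≠ 0 := hp.ne_zero
    simpa [solutionMatrix, hne, hp0] using h
  · rintro ⟨c, -, h⟩
    have h := congrFun (congrFun (congrArg Prod.fst h) ⟨n - 1, by omega⟩) ⟨n - 1, by omega⟩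
    have hne : n - 1 ≠ n - 2 := by omega
    have hn0 : n - 1 ≠ 0 := by omega
    simp only [solutionMatrix, Matrix.of_apply, if_true, if_neg hn0, if_neg hne] at h
    nlinarith
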